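/- Let (X,d,m) be an isotropic PI space and E ⊆ X a set of finite perimeter with m(E) < +∞. Then: (i) if E is a simple set, then both E and X \ E are indecomposable; (ii) if (X,d,m) additionally satisfies property (1.2) and both E and X \ E are indecomposable, then E is a simple set. -/

import Mathlib

open MeasureTheory Metric Filter Set
open scoped ENNReal NNReal Topology

namespace PaperBV

noncomputable section

variable {X : Type*} [MetricSpace X]

/-- `f` is locally Lipschitz on `Ω`. -/
def LocLipOn (Ω : Set X) (f : X → ℝ) : Prop :=
  ∀ x ∈ Ω, ∃ K : ℝ≥0, ∃ t ∈ 𝓝[Ω] x, LipschitzOnWith K f t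

/-- The local Lipschitz constant (slope) `lip f` of a function, with value `0` at
points that are not accumulation points (there the filter `𝓝[≠] x` is trivial). -/
def lipConst (f : X → ℝ) (x : X) : ℝ≥0∞ :=
  Filter.limsup (fun y => ENNReal.ofReal (|f y - f x| / dist y x)) (𝓝[≠] x)

variable [MeasurableSpace X]

/-- Convergence `fn → f` in `L¹_loc(μ⌊Ω)`. -/
def TendstoL1loc (μ : Measure X) (Ω : Set X) (fn : ℕ → X → ℝ) (f : X → ℝ) : Prop :=
  ∀ K : Set X, IsCompact K → K ⊆ Ω →
    Filter.Tendsto (fun n => ∫⁻ x in K, ENNReal.ofReal |fn n x - f x| ∂μ)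
      Filter.atTop (𝓝 0)

/-- The total variation `|Df|(Ω)` of `f` on an open set `Ω`, defined by relaxation of the
integral of the local Lipschitz constant along locally Lipschitz approximations. -/
def tvOpen (μ : Measure X) (f : X → ℝ) (Ω : Set X) : ℝ≥0∞ :=
  sInf { a : ℝ≥0∞ | ∃ fn : ℕ → X → ℝ, (∀ n, LocLipOn Ω (fn n)) ∧ TendstoL1loc μ Ω fn f ∧
    a = Filter.liminf (fun n => ∫⁻ x in Ω, lipConst (fn n) x ∂μ) Filter.atTop }

/-- The total variation measure `|Df|(B)` of `f` on an arbitrary set, obtained from the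
values on open sets by the Carathéodory construction. -/
def tv (μ : Measure X) (f : X → ℝ) (B : Set X) : ℝ≥0∞ :=
  ⨅ (Ω : Set X) (_ : IsOpen Ω) (_ : B ⊆ Ω), tvOpen μ f Ω

/-- `f` is a function of bounded variation: `f ∈ L¹(μ)` and `|Df|(X) < ∞`. -/
def BVFun (μ : Measure X) (f : X → ℝ) : Prop :=
  MeasureTheory.Integrable f μ ∧ tv μ f Set.univ < ⊤

/-- The perimeter `P(E, B) = |D 1_E|(B)`. -/
def perim (μ : Measure X) (E B : Set X) : ℝ≥0∞ :=
  tv μ (E.indicator fun _ => (1 : ℝ)) B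

/-- `E` is a (Borel) set of finite perimeter. -/
def FinPerim (μ : Measure X) (E : Set X) : Prop :=
  MeasurableSet E ∧ perim μ E Set.univ < ⊤

/-- `μ` is a doubling measure with doubling constant `CD`. -/
def Doubling (μ : Measure X) (CD : ℝ≥0) : Prop :=
  1 ≤ CD ∧ ∀ (x : X) (r : ℝ), 0 < r → μ (ball x (2 * r)) ≤ (CD : ℝ≥0∞) * μ (ball x r)

/-- The mean value `f_{x,r}` of `f` on the ball `B_r(x)`. -/
def ballAvg (μ : Measure X) (f : X → ℝ) (x : X) (r : ℝ) : ℝ :=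
  (∫ y in ball x r, f y ∂μ) / (μ (ball x r)).toReal

/-- The weak `(1,1)`-Poincaré inequality with constants `CP`, `lam`,
for locally Lipschitz functions. -/
def WeakPoincare (μ : Measure X) (CP lam : ℝ) : Prop :=
  ∀ f : X → ℝ, LocLipOn Set.univ f → ∀ (x : X) (r : ℝ), 0 < r →
    ∫⁻ y in ball x r, ENNReal.ofReal |f y - ballAvg μ f x r| ∂μ ≤
      ENNReal.ofReal (CP * r) * ∫⁻ y in ball x (lam * r), lipConst f y ∂μ

/-- A PI space: doubling and supporting a weak `(1,1)`-Poincaré inequality. -/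
def IsPI (μ : Measure X) : Prop :=
  ∃ (CD : ℝ≥0) (CP lam : ℝ), Doubling μ CD ∧ 0 < CP ∧ 1 ≤ lam ∧ WeakPoincare μ CP lam

/-- The pre-measure `H_δ` of the codimension-one Hausdorff measure: infimum over countable
covers by balls of radii at most `δ` of `∑ μ(B_{r_i}(x_i)) / (2 r_i)`. -/
def preH (μ : Measure X) (δ : ℝ) (S : Set X) : ℝ≥0∞ :=
  ⨅ (c : ℕ → X × ℝ) (_ : ∀ i, 0 < (c i).2 ∧ (c i).2 ≤ δ)
    (_ : S ⊆ ⋃ i, ball (c i).1 (c i).2),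
    ∑' i, μ (ball (c i).1 (c i).2) / ENNReal.ofReal (2 * (c i).2)

/-- The codimension-one Hausdorff measure `H = lim_{δ ↓ 0} H_δ = sup_{δ > 0} H_δ`
(as an outer-measure-type set function). -/
def codimH (μ : Measure X) (S : Set X) : ℝ≥0∞ :=
  ⨆ (δ : ℝ) (_ : 0 < δ), preH μ δ S

/-- The upper density of `E` at `x`. -/
def upperDens (μ : Measure X) (E : Set X) (x : X) : ℝ≥0∞ :=
  Filter.limsup (fun r : ℝ => μ (E ∩ ball x r) / μ (ball x r)) (𝓝[>] (0 : ℝ))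

/-- The essential boundary `∂^e E`. -/
def essBdry (μ : Measure X) (E : Set X) : Set X :=
  {x | 0 < upperDens μ E x ∧ 0 < upperDens μ Eᶜ x}

/-- The essential interior `E^1`: points of density `1`. -/
def essInt (μ : Measure X) (E : Set X) : Set X :=
  {x | Filter.Tendsto (fun r : ℝ => μ (E ∩ ball x r) / μ (ball x r))
    (𝓝[>] (0 : ℝ)) (𝓝 (1 : ℝ≥0∞))}

/-- Integral `∫_S f dν` with respect to an outer-measure-type set function `ν`,
via the layer-cake formula. -/
def outerLint (ν : Set X → ℝ≥0∞) (S : Set X) (f : X → ℝ≥0∞) : ℝ≥0∞ :=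
  ∫⁻ t in Set.Ioi (0 : ℝ), ν {x ∈ S | ENNReal.ofReal t < f x}

/-- `θ` is a family of densities representing the perimeter measures with respect to the
codimension-one Hausdorff measure: `P(E,B) = ∫_{B ∩ ∂^e E} θ_E dH`, with
`γ ≤ θ_E ≤ C` on `∂^e E` for structural constants `0 < γ`, `C < ∞`. -/
def PerimRepr (μ : Measure X) (θ : Set X → X → ℝ≥0∞) : Prop :=
  ∃ γ C : ℝ≥0∞, 0 < γ ∧ C ≠ ⊤ ∧
    ∀ E : Set X, FinPerim μ E →
      (∀ x ∈ essBdry μ E, γ ≤ θ E x ∧ θ E x ≤ C) ∧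
      ∀ B : Set X, MeasurableSet B →
        perim μ E B = outerLint (codimH μ) (B ∩ essBdry μ E) (θ E)

/-- The space is isotropic: the densities `θ_E` can be chosen so that, whenever `F ⊆ E` are
sets of finite perimeter, `θ_F = θ_E` holds `H`-a.e. on `∂^e F ∩ ∂^e E`. -/
def Isotropic (μ : Measure X) : Prop :=
  ∃ θ : Set X → X → ℝ≥0∞, PerimRepr μ θ ∧
    ∀ E F : Set X, FinPerim μ E → FinPerim μ F → F ⊆ E →
      codimH μ {x ∈ essBdry μ F ∩ essBdry μ E | θ F x ≠ θ E x} = 0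

/-- Property (1.2): `H(∂^e E ∩ ∂^e F ∩ ∂^e (E ∪ F)) = 0` for disjoint sets of finite
perimeter. -/
def Prop12 (μ : Measure X) : Prop :=
  ∀ E F : Set X, FinPerim μ E → FinPerim μ F → Disjoint E F →
    codimH μ (essBdry μ E ∩ essBdry μ F ∩ essBdry μ (E ∪ F)) = 0

/-- `E` is decomposable in `B`: `E ∩ B` admits a partition into two sets of finite perimeter
and positive measure such that the perimeter in `B` is additive. -/
def DecomposableIn (μ : Measure X) (E B : Set X) : Prop :=
  ∃ F G : Set X, FinPerim μ F ∧ FinPerim μ G ∧ Disjoint F G ∧ F ∪ G = E ∩ B ∧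
    0 < μ F ∧ 0 < μ G ∧ perim μ E B = perim μ F B + perim μ G B

/-- `E` is a set of finite perimeter which is indecomposable in `B`. -/
def IndecomposableIn (μ : Measure X) (E B : Set X) : Prop :=
  FinPerim μ E ∧ ¬ DecomposableIn μ E B

/-- `E` is an indecomposable set (of finite perimeter). -/
def Indecomposable (μ : Measure X) (E : Set X) : Prop :=
  IndecomposableIn μ E Set.univ

/-- `E` is a simple set. -/
def SimpleSet (μ : Measure X) (E : Set X) : Prop :=
  FinPerim μ E ∧ μ E < ⊤ ∧
  ∀ F : Set X, FinPerim μ F → codimH μ (essBdry μ F \ essBdry μ E) = 0 →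
    μ F = 0 ∨ μ Fᶜ = 0 ∨ μ (symmDiff F E) = 0 ∨ μ (symmDiff F Eᶜ) = 0

end

section LayerCake

variable {X : Type*}

/-! ### Layer-cake integrals against an outer measure -/

theorem outerLint_le_of_null (H : OuterMeasure X) {S T : Set X} {f g : X → ℝ≥0∞}
    (h : H {x ∈ S | ¬(x ∈ T ∧ f x = g x)} = 0) : outerLint H S f ≤ outerLint H T g := by
  refine lintegral_mono fun t => ?_
  calc H {x ∈ S | ENNReal.ofReal t < f x}
      ≤ H ({x ∈ T | ENNReal.ofReal t < g x} ∪ {x ∈ S | ¬(x ∈ T ∧ f x = g x)}) := by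
        refine measure_mono fun x hx => ?_
        by_cases hxT : x ∈ T ∧ f x = g x
        · exact Or.inl ⟨hxT.1, hxT.2 ▸ hx.2⟩
        · exact Or.inr ⟨hx.1, hxT⟩
    _ ≤ H {x ∈ T | ENNReal.ofReal t < g x} + 0 := h ▸ measure_union_le _ _
    _ = _ := add_zero _

theorem measurable_superlevel (H : OuterMeasure X) (S : Set X) (f : X → ℝ≥0∞) :
    Measurable fun t : ℝ => H {x ∈ S | ENNReal.ofReal t < f x} :=
  Antitone.measurable fun _ _ h => measure_mono fun _ hx =>
    ⟨hx.1, (ENNReal.ofReal_le_ofReal h).trans_lt hx.2⟩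

theorem outerLint_inter_add_diff (H : OuterMeasure X) {B : Set X}
    (hB : ∀ S, H S = H (S ∩ B) + H (S \ B)) (S : Set X) (f : X → ℝ≥0∞) :
    outerLint H S f = outerLint H (S ∩ B) f + outerLint H (S \ B) f := by
  unfold outerLint
  rw [← lintegral_add_left (measurable_superlevel H _ f)]
  refine lintegral_congr fun t => ?_
  rw [hB]
  congr 2 <;> ext x <;> simp only [mem_inter_iff, Set.mem_sdiff, mem_ofPred_eq] <;> tauto

theorem measure_eq_zero_of_outerLint_eq_zero (H : OuterMeasure X) {S : Set X} {f : X → ℝ≥0∞}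
    {γ : ℝ≥0∞} (hγ : 0 < γ) (hf : ∀ x ∈ S, γ ≤ f x) (h : outerLint H S f = 0) : H S = 0 := by
  obtain ⟨c, hc0, hcγ⟩ := ENNReal.lt_iff_exists_nnreal_btwn.1 hγ
  have hle : ENNReal.ofReal c * H S ≤ outerLint H S f := by
    calc ENNReal.ofReal c * H S = ∫⁻ _ in Ioo (0 : ℝ) c, H S := by
          simp [mul_comm]
      _ ≤ ∫⁻ t in Ioo (0 : ℝ) c, H {x ∈ S | ENNReal.ofReal t < f x} := by
          refine setLIntegral_mono' measurableSet_Ioo fun t ht => measure_mono fun x hx => ?_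
          refine ⟨hx, lt_of_lt_of_le ?_ (hf x hx)⟩
          refine lt_of_le_of_lt (ENNReal.ofReal_le_ofReal ht.2.le) ?_
          simpa using hcγ
      _ ≤ outerLint H S f := lintegral_mono_set Ioo_subset_Ioi_self
  rw [h, nonpos_iff_eq_zero, mul_eq_zero] at hle
  refine hle.resolve_left ?_
  simpa using hc0.ne'

end LayerCake

section LocallyLipschitz

variable {X : Type*} [MetricSpace X]

/-! ### Locally Lipschitz functions -/

theorem LocLipOn.continuous {f : X → ℝ} (hf : LocLipOn univ f) : Continuous f := by
  refine continuous_iff_continuousAt.2 fun x => ?_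
  obtain ⟨K, t, ht, hK⟩ := hf x (mem_univ x)
  exact hK.continuousOn.continuousAt (by simpa using ht)

theorem LocLipOn.const_sub {Ω : Set X} {f : X → ℝ} (hf : LocLipOn Ω f) (a : ℝ) :
    LocLipOn Ω fun x => a - f x := by
  intro x hx
  obtain ⟨K, t, ht, hK⟩ := hf x hx
  refine ⟨K, t, ht, fun y hy z hz => ?_⟩
  simpa only [edist_dist, Real.dist_eq, sub_sub_sub_cancel_left, abs_sub_comm (f z)] using
    hK hy hz

theorem LocLipOn.min {Ω : Set X} {f g : X → ℝ} (hf : LocLipOn Ω f) (hg : LocLipOn Ω g) :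
    LocLipOn Ω fun x => min (f x) (g x) := by
  intro x hx
  obtain ⟨K, t, ht, hK⟩ := hf x hx
  obtain ⟨K', t', ht', hK'⟩ := hg x hx
  refine ⟨max K K', t ∩ t', inter_mem ht ht', ?_⟩
  rw [lipschitzOnWith_iff_restrict]
  exact (hK.mono inter_subset_left).to_restrict.min (hK'.mono inter_subset_right).to_restrict

theorem lipConst_const_sub (a : ℝ) (f : X → ℝ) : lipConst (fun x => a - f x) = lipConst f := by
  funext x
  unfold lipConst
  congr 1
  funext y
  rw [show a - f y - (a - f x) = -(f y - f x) by ring, abs_neg]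

theorem lipConst_min_le (f g : X → ℝ) (x : X) :
    lipConst (fun x => min (f x) (g x)) x ≤ lipConst f x + lipConst g x := by
  have h : lipConst (fun x => min (f x) (g x)) x ≤ max (lipConst f x) (lipConst g x) := by
    unfold lipConst
    rw [← limsup_max]
    refine limsup_le_limsup (Eventually.of_forall fun y => ?_)
    dsimp only
    rw [← ENNReal.ofReal_max]
    refine ENNReal.ofReal_le_ofReal ?_
    rw [max_div_div_right dist_nonneg]
    gcongr
    exact abs_min_sub_min_le_max _ _ _ _
  exact h.trans (max_le le_self_add le_add_self)

theorem lowerSemicontinuous_iSup_slope {f : X → ℝ} (hf : Continuous f) (ε : ℝ) :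
    LowerSemicontinuous fun x => ⨆ y ∈ ball x ε ∩ {x}ᶜ,
      ENNReal.ofReal (|f y - f x| / dist y x) := by
  intro x a ha
  simp only [lt_iSup_iff] at ha ⊢
  obtain ⟨y, ⟨hyε, hyx⟩, hy⟩ := ha
  have hyx' : dist y x ≠ 0 := dist_ne_zero.2 hyx
  have hcont : ContinuousAt (fun z => ENNReal.ofReal (|f y - f z| / dist y z)) x :=
    ENNReal.continuous_ofReal.continuousAt.comp
      (ContinuousAt.div (by fun_prop) (by fun_prop) hyx')
  have hball : ∀ᶠ z in 𝓝 x, dist y z < ε :=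
    (continuous_const.dist continuous_id).continuousAt.eventually_lt continuousAt_const hyε
  filter_upwards [hcont.eventually (lt_mem_nhds hy), hball,
    isOpen_ne.mem_nhds (Ne.symm hyx)] with z hz hzε hzy
  exact ⟨y, ⟨hzε, Ne.symm hzy⟩, hz⟩

end LocallyLipschitz

noncomputable section Auxiliary

variable {X : Type*} [MetricSpace X] [MeasurableSpace X]

/-! ### The codimension-one Hausdorff measure is a metric outer measure -/

/-- The sum of `μ (B_r(x)) / (2 r)` over a sequence of balls. -/
def coverCost (μ : Measure X) (c : ℕ → X × ℝ) : ℝ≥0∞ :=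
  ∑' i, μ (ball (c i).1 (c i).2) / ENNReal.ofReal (2 * (c i).2)

theorem preH_le_coverCost (μ : Measure X) {δ : ℝ} {S : Set X} (c : ℕ → X × ℝ)
    (hc : ∀ i, 0 < (c i).2 ∧ (c i).2 ≤ δ) (hS : S ⊆ ⋃ i, ball (c i).1 (c i).2) :
    preH μ δ S ≤ coverCost μ c :=
  iInf_le_of_le c (iInf_le_of_le hc (iInf_le_of_le hS le_rfl))

theorem exists_cover_of_preH_lt (μ : Measure X) {δ : ℝ} {S : Set X} {a : ℝ≥0∞}
    (h : preH μ δ S < a) :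
    ∃ c : ℕ → X × ℝ, (∀ i, 0 < (c i).2 ∧ (c i).2 ≤ δ) ∧
      (S ⊆ ⋃ i, ball (c i).1 (c i).2) ∧ coverCost μ c < a := by
  simp only [preH, iInf_lt_iff] at h
  obtain ⟨c, hc, hS, h⟩ := h
  exact ⟨c, hc, hS, h⟩

theorem preH_mono (μ : Measure X) (δ : ℝ) {S T : Set X} (h : S ⊆ T) :
    preH μ δ S ≤ preH μ δ T :=
  le_iInf fun c => le_iInf fun hc => le_iInf fun hT =>
    preH_le_coverCost μ c hc (h.trans hT)

theorem preH_anti (μ : Measure X) {δ δ' : ℝ} (h : δ ≤ δ') (S : Set X) :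
    preH μ δ' S ≤ preH μ δ S :=
  le_iInf fun c => le_iInf fun hc => le_iInf fun hT =>
    preH_le_coverCost μ c (fun i => ⟨(hc i).1, (hc i).2.trans h⟩) hT

theorem preH_le_codimH (μ : Measure X) {δ : ℝ} (hδ : 0 < δ) (S : Set X) :
    preH μ δ S ≤ codimH μ S :=
  le_iSup₂_of_le δ hδ le_rfl

theorem codimH_mono (μ : Measure X) {S T : Set X} (h : S ⊆ T) : codimH μ S ≤ codimH μ T :=
  iSup₂_mono fun δ _ => preH_mono μ δ h

theorem preH_iUnion_le (μ : Measure X) (δ : ℝ) (s : ℕ → Set X) :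
    preH μ δ (⋃ n, s n) ≤ ∑' n, preH μ δ (s n) := by
  by_cases htop : ∑' n, preH μ δ (s n) = ⊤
  · simp [htop]
  refine ENNReal.le_of_forall_pos_le_add fun ε hε _ => ?_
  obtain ⟨ε', hε', hsum⟩ := ENNReal.exists_pos_sum_of_countable'
    (ENNReal.coe_ne_zero.2 hε.ne') ℕ
  have hex : ∀ n, ∃ c : ℕ → X × ℝ, (∀ i, 0 < (c i).2 ∧ (c i).2 ≤ δ) ∧
      (s n ⊆ ⋃ i, ball (c i).1 (c i).2) ∧ coverCost μ c < preH μ δ (s n) + ε' n := fun n =>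
    exists_cover_of_preH_lt μ
      (ENNReal.lt_add_right (ENNReal.ne_top_of_tsum_ne_top htop n) (hε' n).ne')
  choose c hc hcov hcost using hex
  let e := Nat.pairEquiv.symm
  refine (preH_le_coverCost μ (fun k => c (e k).1 (e k).2) (fun k => hc _ _) ?_).trans ?_
  · refine iUnion_subset fun n x hx => ?_
    obtain ⟨i, hi⟩ := mem_iUnion.1 (hcov n hx)
    refine mem_iUnion.2 ⟨e.symm (n, i), ?_⟩
    simpa using hi
  · calc coverCost μ (fun k => c (e k).1 (e k).2)
        = ∑' p : ℕ × ℕ, μ (ball (c p.1 p.2).1 (c p.1 p.2).2) /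
            ENNReal.ofReal (2 * (c p.1 p.2).2) :=
          e.tsum_eq (fun p : ℕ × ℕ => μ (ball (c p.1 p.2).1 (c p.1 p.2).2) /
            ENNReal.ofReal (2 * (c p.1 p.2).2))
      _ = ∑' n, coverCost μ (c n) :=
          ENNReal.tsum_prod (f := fun n i => μ (ball (c n i).1 (c n i).2) /
            ENNReal.ofReal (2 * (c n i).2))
      _ ≤ ∑' n, (preH μ δ (s n) + ε' n) := ENNReal.tsum_le_tsum fun n => (hcost n).le
      _ ≤ ∑' n, preH μ δ (s n) + ε := by
          rw [ENNReal.tsum_add]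
          gcongr

/-- The codimension-one Hausdorff measure as an outer measure. Covers being indexed by `ℕ`
with positive radii, the empty set needs to be assumed null. -/
def codimHOuter (μ : Measure X) (h0 : codimH μ ∅ = 0) : OuterMeasure X where
  measureOf := codimH μ
  empty := h0
  mono := codimH_mono μ
  iUnion_nat s _ := iSup₂_le fun δ hδ =>
    (preH_iUnion_le μ δ s).trans (ENNReal.tsum_le_tsum fun _ => preH_le_codimH μ hδ _)

theorem coe_codimHOuter (μ : Measure X) (h0 : codimH μ ∅ = 0) :
    ⇑(codimHOuter μ h0) = codimH μ := rfl

theorem preH_add_le_of_separated (μ : Measure X) (h0 : codimH μ ∅ = 0) {S T : Set X} {δ : ℝ}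
    (hδ : 0 < δ) (hsep : ∀ x ∈ S, ∀ y ∈ T, 2 * δ ≤ dist x y) :
    preH μ δ S + preH μ δ T ≤ preH μ δ (S ∪ T) := by
  classical
  refine le_iInf fun c => le_iInf fun hc => le_iInf fun hcov => ?_
  change _ ≤ coverCost μ c
  refine ENNReal.le_of_forall_pos_le_add fun ε hε _ => ?_
  have hpre : preH μ δ ∅ < (ε / 2 : ℝ≥0) := by
    refine ((preH_le_codimH μ hδ ∅).trans_eq h0).trans_lt ?_
    exact_mod_cast half_pos hε
  obtain ⟨j, hj, -, hjcost⟩ := exists_cover_of_preH_lt μ hpre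
  let w : X × ℝ → ℝ≥0∞ := fun p => μ (ball p.1 p.2) / ENNReal.ofReal (2 * p.2)
  let cov : Set X → ℕ → X × ℝ := fun A i =>
    if (ball (c i).1 (c i).2 ∩ A).Nonempty then c i else j i
  have hle : ∀ A ⊆ S ∪ T, preH μ δ A ≤ coverCost μ (cov A) := by
    intro A hA
    refine preH_le_coverCost μ _ (fun i => ?_) fun x hx => ?_
    · by_cases h : (ball (c i).1 (c i).2 ∩ A).Nonempty
      · simpa only [cov, if_pos h] using hc i
      · simpa only [cov, if_neg h] using hj i
    · obtain ⟨i, hi⟩ := mem_iUnion.1 (hcov (hA hx))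
      have h : (ball (c i).1 (c i).2 ∩ A).Nonempty := ⟨x, hi, hx⟩
      exact mem_iUnion.2 ⟨i, by simpa only [cov, if_pos h] using hi⟩
  have hpoint : ∀ i, w (cov S i) + w (cov T i) ≤ w (c i) + (w (j i) + w (j i)) := by
    intro i
    by_cases hS : (ball (c i).1 (c i).2 ∩ S).Nonempty
    · have hT : ¬ (ball (c i).1 (c i).2 ∩ T).Nonempty := by
        rintro ⟨y, hy, hyT⟩
        obtain ⟨x, hx, hxS⟩ := hS
        have h₁ := hsep x hxS y hyT
        have h₂ := dist_triangle_right x y (c i).1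
        have h₃ := (hc i).2
        rw [mem_ball] at hx hy
        linarith
      simp only [cov, if_pos hS, if_neg hT]
      gcongr
      exact le_self_add
    · simp only [cov, if_neg hS]
      by_cases hT : (ball (c i).1 (c i).2 ∩ T).Nonempty
      · simp only [if_pos hT]
        rw [add_comm]
        gcongr
        exact le_self_add
      · simp only [if_neg hT]
        exact le_add_self
  calc preH μ δ S + preH μ δ T
      ≤ coverCost μ (cov S) + coverCost μ (cov T) :=
        add_le_add (hle S subset_union_left) (hle T subset_union_right)
    _ = ∑' i, (w (cov S i) + w (cov T i)) := ENNReal.tsum_add.symm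
    _ ≤ ∑' i, (w (c i) + (w (j i) + w (j i))) := ENNReal.tsum_le_tsum hpoint
    _ = coverCost μ c + (coverCost μ j + coverCost μ j) := by
        rw [ENNReal.tsum_add, ENNReal.tsum_add]; rfl
    _ ≤ coverCost μ c + ((ε / 2 : ℝ≥0) + (ε / 2 : ℝ≥0)) := by gcongr
    _ = coverCost μ c + ε := by rw [← ENNReal.coe_add, add_halves]

theorem isMetric_codimHOuter (μ : Measure X) (h0 : codimH μ ∅ = 0) :
    (codimHOuter μ h0).IsMetric := by
  rintro S T ⟨r, hr0, hr⟩
  refine le_antisymm (measure_union_le S T) ?_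
  obtain ⟨ρ, hρ0, hρ⟩ : ∃ ρ : ℝ, 0 < ρ ∧ ∀ x ∈ S, ∀ y ∈ T, ρ ≤ dist x y := by
    refine ⟨(min r 1).toReal, ENNReal.toReal_pos (by simp [hr0]) (by simp), fun x hx y hy => ?_⟩
    rw [dist_edist]
    exact ENNReal.toReal_mono (edist_ne_top x y) ((min_le_left _ _).trans (hr x hx y hy))
  simp only [coe_codimHOuter]
  conv_lhs => simp only [codimH]
  refine ENNReal.biSup_add_biSup_le' (p := fun δ : ℝ => 0 < δ) (q := fun δ : ℝ => 0 < δ)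
    ⟨1, one_pos⟩ ⟨1, one_pos⟩ fun δ hδ δ' hδ' => ?_
  have hη : 0 < min (min δ δ') (ρ / 2) := by positivity
  calc preH μ δ S + preH μ δ' T
      ≤ preH μ (min (min δ δ') (ρ / 2)) S + preH μ (min (min δ δ') (ρ / 2)) T :=
        add_le_add (preH_anti μ ((min_le_left _ _).trans (min_le_left _ _)) _)
          (preH_anti μ ((min_le_left _ _).trans (min_le_right _ _)) _)
    _ ≤ preH μ (min (min δ δ') (ρ / 2)) (S ∪ T) :=
        preH_add_le_of_separated μ h0 hη fun x hx y hy => by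
          have h₁ := hρ x hx y hy
          have h₂ := min_le_right (min δ δ') (ρ / 2)
          linarith
    _ ≤ codimH μ (S ∪ T) := preH_le_codimH μ hη _

theorem codimHOuter_inter_add_diff [BorelSpace X] (μ : Measure X) (h0 : codimH μ ∅ = 0)
    {B : Set X} (hB : MeasurableSet B) (S : Set X) :
    codimHOuter μ h0 S = codimHOuter μ h0 (S ∩ B) + codimHOuter μ h0 (S \ B) := by
  have h := (isMetric_codimHOuter μ h0).borel_le_caratheodory
  rw [← BorelSpace.measurable_eq (α := X)] at h
  exact h B hB S

/-! ### The essential boundary -/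

theorem upperDens_mono (μ : Measure X) {E F : Set X} (h : E ⊆ F) (x : X) :
    upperDens μ E x ≤ upperDens μ F x :=
  limsup_le_limsup (Eventually.of_forall fun _ =>
    ENNReal.div_le_div_right (measure_mono (inter_subset_inter_left _ h)) _)

theorem upperDens_union_pos (μ : Measure X) {E F : Set X} {x : X}
    (h : 0 < upperDens μ (E ∪ F) x) : 0 < upperDens μ E x ∨ 0 < upperDens μ F x := by
  by_contra! hcon
  have hlim : ∀ A : Set X, upperDens μ A x ≤ 0 →
      Tendsto (fun r : ℝ => μ (A ∩ ball x r) / μ (ball x r)) (𝓝[>] (0 : ℝ)) (𝓝 0) :=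
    fun A hA => tendsto_of_le_liminf_of_limsup_le bot_le hA
  have hsum := (hlim E hcon.1).add (hlim F hcon.2)
  rw [add_zero] at hsum
  have hunion : Tendsto (fun r : ℝ => μ ((E ∪ F) ∩ ball x r) / μ (ball x r))
      (𝓝[>] (0 : ℝ)) (𝓝 0) := by
    refine tendsto_of_tendsto_of_tendsto_of_le_of_le tendsto_const_nhds hsum
      (fun _ => bot_le) fun r => ?_
    simp only [← ENNReal.add_div, union_inter_distrib_right]
    gcongr
    exact measure_union_le _ _
  exact h.ne' hunion.limsup_eq

theorem essBdry_compl (μ : Measure X) (E : Set X) : essBdry μ Eᶜ = essBdry μ E := by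
  ext x
  simp only [essBdry, compl_compl, mem_ofPred_eq, and_comm]

theorem essBdry_union_subset (μ : Measure X) (E F : Set X) :
    essBdry μ (E ∪ F) ⊆ essBdry μ E ∪ essBdry μ F := by
  rintro x ⟨h₁, h₂⟩
  rw [compl_union] at h₂
  rcases upperDens_union_pos μ h₁ with h | h
  · exact Or.inl ⟨h, h₂.trans_le (upperDens_mono μ inter_subset_left x)⟩
  · exact Or.inr ⟨h, h₂.trans_le (upperDens_mono μ inter_subset_right x)⟩

theorem essBdry_inter_subset (μ : Measure X) (E F : Set X) :
    essBdry μ (E ∩ F) ⊆ essBdry μ E ∪ essBdry μ F := by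
  rw [← essBdry_compl μ (E ∩ F), compl_inter, ← essBdry_compl μ E, ← essBdry_compl μ F]
  exact essBdry_union_subset μ _ _

theorem exists_rat_lt_measure_inter_ball (μ : Measure X) (E : Set X) (x : X) {r : ℝ}
    (hr : 0 < r) {a : ℝ≥0∞} (h : a < μ (E ∩ ball x r)) :
    ∃ s : ℚ, 0 < (s : ℝ) ∧ (s : ℝ) < r ∧ a < μ (E ∩ ball x s) := by
  obtain ⟨u, hu, hu_mem, hu_lim⟩ := exists_seq_strictMono_tendsto' hr
  have hunion : ⋃ n, E ∩ ball x (u n) = E ∩ ball x r := by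
    rw [← inter_iUnion]
    congr 1
    ext y
    simp only [mem_iUnion, mem_ball]
    refine ⟨fun ⟨n, hn⟩ => hn.trans (hu_mem n).2, fun hy => ?_⟩
    exact (hu_lim.eventually (lt_mem_nhds hy)).exists
  have hmono : Monotone fun n => E ∩ ball x (u n) := fun m n hmn =>
    inter_subset_inter_right _ (ball_subset_ball (hu.monotone hmn))
  rw [← hunion, hmono.measure_iUnion, lt_iSup_iff] at h
  obtain ⟨n, hn⟩ := h
  obtain ⟨s, hs₁, hs₂⟩ := exists_rat_btwn (hu_mem n).2
  exact ⟨s, (hu_mem n).1.trans hs₁, hs₂,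
    hn.trans_le (measure_mono (inter_subset_inter_right _ (ball_subset_ball hs₁.le)))⟩

theorem upperDens_pos_iff (μ : Measure X) (E : Set X) (x : X) :
    0 < upperDens μ E x ↔ ∃ n : ℕ, ∀ k : ℕ, ∃ s : ℚ, 0 < (s : ℝ) ∧ (s : ℝ) < 1 / (k + 1) ∧
      ((n : ℝ≥0∞) + 1)⁻¹ * μ (ball x s) < μ (E ∩ ball x s) := by
  constructor
  · intro h
    obtain ⟨n, hn⟩ := ENNReal.exists_inv_nat_lt h.ne'
    have hn' : ((n : ℝ≥0∞) + 1)⁻¹ < upperDens μ E x :=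
      (ENNReal.inv_le_inv.2 le_self_add).trans_lt hn
    have hfreq := frequently_lt_of_lt_limsup (by isBoundedDefault) hn'
    refine ⟨n, fun k => ?_⟩
    have hev : ∀ᶠ r in 𝓝[>] (0 : ℝ), r ∈ Ioo (0 : ℝ) (1 / (k + 1)) :=
      Ioo_mem_nhdsGT (by positivity)
    obtain ⟨r, hr, hr0, hrk⟩ := (hfreq.and_eventually hev).exists
    obtain ⟨s, hs0, hsr, hs⟩ :=
      exists_rat_lt_measure_inter_ball μ E x hr0 (ENNReal.mul_lt_of_lt_div hr)
    refine ⟨s, hs0, hsr.trans hrk, lt_of_le_of_lt ?_ hs⟩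
    gcongr
  · rintro ⟨n, hn⟩
    have hc : (0 : ℝ≥0∞) < ((n : ℝ≥0∞) + 1)⁻¹ := by
      simp only [ENNReal.inv_pos]
      finiteness
    refine hc.trans_le (le_limsup_of_frequently_le ?_ (by isBoundedDefault))
    rw [(nhdsGT_basis (0 : ℝ)).frequently_iff]
    intro ε hε
    obtain ⟨k, hk⟩ := exists_nat_one_div_lt hε
    obtain ⟨s, hs0, hsk, hs⟩ := hn k
    refine ⟨s, ⟨hs0, hsk.trans hk⟩, ?_⟩
    have hle : μ (E ∩ ball x s) ≤ μ (ball x s) := measure_mono inter_subset_right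
    have hne0 : μ (ball x s) ≠ 0 := (bot_le.trans_lt hs |>.trans_le hle).ne'
    have hneTop : μ (ball x s) ≠ ⊤ := by
      intro htop
      rw [htop, ENNReal.mul_top hc.ne'] at hs
      exact not_top_lt hs
    exact ((ENNReal.lt_div_iff_mul_lt (Or.inl hne0) (Or.inl hneTop)).2 hs).le

section Measurability

variable [SecondCountableTopology X] [BorelSpace X]

theorem measurable_measure_inter_ball (μ : Measure X) [SFinite μ] {E : Set X}
    (hE : MeasurableSet E) (r : ℝ) : Measurable fun x => μ (E ∩ ball x r) := by
  have hset : MeasurableSet {p : X × X | p.2 ∈ E ∧ dist p.2 p.1 < r} :=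
    (measurable_snd hE).inter
      (measurableSet_lt (measurable_snd.dist measurable_fst) measurable_const)
  exact measurable_measure_prodMk_left (ν := μ) hset

theorem measurableSet_upperDens_pos (μ : Measure X) [SFinite μ] {E : Set X}
    (hE : MeasurableSet E) : MeasurableSet {x | 0 < upperDens μ E x} := by
  simp only [upperDens_pos_iff, ← exists_prop, ofPred_exists, ofPred_forall]
  refine .iUnion fun n => .iInter fun k => .iUnion fun s => .iUnion fun _ => .iUnion fun _ => ?_
  have hball : Measurable fun x => μ (ball x (s : ℝ)) := by
    simpa using measurable_measure_inter_ball μ MeasurableSet.univ (s : ℝ)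
  exact measurableSet_lt (hball.const_mul _) (measurable_measure_inter_ball μ hE _)

theorem measurableSet_essBdry (μ : Measure X) [SFinite μ] {E : Set X}
    (hE : MeasurableSet E) : MeasurableSet (essBdry μ E) :=
  (measurableSet_upperDens_pos μ hE).inter (measurableSet_upperDens_pos μ hE.compl)

end Measurability

/-! ### Sets of finite perimeter -/

theorem measurable_lipConst [OpensMeasurableSpace X] {f : X → ℝ} (hf : Continuous f) :
    Measurable (lipConst f) := by
  have hbasis : ∀ x : X, (𝓝[≠] x).HasBasis (fun _ : ℕ => True)
      fun n => ball x (1 / ((n : ℝ) + 1)) ∩ {x}ᶜ := fun x =>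
    nhdsWithin_hasBasis nhds_basis_ball_inv_nat_succ _
  have heq : lipConst f = fun x => ⨅ n : ℕ, ⨆ y ∈ ball x (1 / ((n : ℝ) + 1)) ∩ {x}ᶜ,
      ENNReal.ofReal (|f y - f x| / dist y x) := by
    funext x
    rw [lipConst, (hbasis x).limsup_eq_iInf_iSup]
    simp only [iInf_pos]
  rw [heq]
  exact .iInf fun n => (lowerSemicontinuous_iSup_slope hf _).measurable

theorem tv_univ (μ : Measure X) (f : X → ℝ) : tv μ f univ = tvOpen μ f univ := by
  refine le_antisymm (iInf_le_of_le univ (iInf_le_of_le isOpen_univ (iInf_le _ subset_rfl))) ?_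
  refine le_iInf fun Ω => le_iInf fun _ => le_iInf fun h => ?_
  rw [univ_subset_iff.1 h]

/-- Finiteness of the total variation means that there is an approximating sequence of locally
Lipschitz functions whose slopes have bounded integrals. -/
theorem tv_univ_lt_top_iff (μ : Measure X) (f : X → ℝ) :
    tv μ f univ < ⊤ ↔ ∃ fn : ℕ → X → ℝ, (∀ n, LocLipOn univ (fn n)) ∧
      TendstoL1loc μ univ fn f ∧ ∃ C < ⊤, ∀ n, ∫⁻ x, lipConst (fn n) x ∂μ ≤ C := by
  rw [tv_univ]
  constructor
  · intro h
    obtain ⟨a, ⟨fn, hlip, hlim, rfl⟩, ha⟩ := sInf_lt_iff.1 h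
    obtain ⟨C, hC, hCtop⟩ := exists_between ha
    obtain ⟨φ, hφ, hφC⟩ := extraction_of_frequently_atTop
      (frequently_lt_of_liminf_lt (by isBoundedDefault) hC)
    refine ⟨fun n => fn (φ n), fun n => hlip _,
      fun K hK hKu => (hlim K hK hKu).comp hφ.tendsto_atTop, C, hCtop, fun n => ?_⟩
    simpa using (hφC n).le
  · rintro ⟨fn, hlip, hlim, C, hC, hbound⟩
    have hle : tvOpen μ f univ ≤ liminf (fun n => ∫⁻ x in univ, lipConst (fn n) x ∂μ) atTop :=
      sInf_le ⟨fn, hlip, hlim, rfl⟩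
    refine (hle.trans ?_).trans_lt hC
    refine liminf_le_of_frequently_le (Frequently.of_forall fun n => ?_) (by isBoundedDefault)
    simpa using hbound n

theorem finPerim_empty (μ : Measure X) : FinPerim μ ∅ := by
  refine ⟨MeasurableSet.empty, (tv_univ_lt_top_iff μ _).2 ⟨fun _ _ => 0, fun _ x _ =>
    ⟨0, univ, univ_mem, (LipschitzWith.const 0).lipschitzOnWith⟩, fun K _ _ => by simp, 0,
      ENNReal.zero_lt_top, fun n => ?_⟩⟩
  have hzero : ∀ x : X, lipConst (fun _ : X => (0 : ℝ)) x = 0 := fun x =>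
    nonpos_iff_eq_zero.1 (limsup_le_of_le (by isBoundedDefault) (by simp))
  simp [hzero]

theorem FinPerim.compl {μ : Measure X} {E : Set X} (hE : FinPerim μ E) : FinPerim μ Eᶜ := by
  obtain ⟨fn, hlip, hlim, C, hC, hbound⟩ := (tv_univ_lt_top_iff μ _).1 hE.2
  refine ⟨hE.1.compl, (tv_univ_lt_top_iff μ _).2 ⟨fun n x => 1 - fn n x,
    fun n => (hlip n).const_sub 1, fun K hK hKu => ?_, C, hC, fun n => ?_⟩⟩
  · convert hlim K hK hKu using 5 with n x
    rw [← abs_neg]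
    congr 1
    by_cases hx : x ∈ E <;> simp [hx]
  · rw [lipConst_const_sub]
    exact hbound n

theorem FinPerim.inter [BorelSpace X] {μ : Measure X} {E F : Set X} (hE : FinPerim μ E)
    (hF : FinPerim μ F) : FinPerim μ (E ∩ F) := by
  obtain ⟨fn, hflip, hflim, C, hC, hfC⟩ := (tv_univ_lt_top_iff μ _).1 hE.2
  obtain ⟨gn, hglip, hglim, D, hD, hgD⟩ := (tv_univ_lt_top_iff μ _).1 hF.2
  refine ⟨hE.1.inter hF.1, (tv_univ_lt_top_iff μ _).2 ⟨fun n x => min (fn n x) (gn n x),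
    fun n => (hflip n).min (hglip n), fun K hK hKu => ?_, C + D, ENNReal.add_lt_top.2 ⟨hC, hD⟩,
    fun n => ?_⟩⟩
  · have hsum := (hflim K hK hKu).add (hglim K hK hKu)
    rw [add_zero] at hsum
    refine tendsto_of_tendsto_of_tendsto_of_le_of_le tendsto_const_nhds hsum
      (fun _ => bot_le) fun n => ?_
    have hmeas : Measurable fun x => ENNReal.ofReal |fn n x - E.indicator (fun _ => 1) x| :=
      ENNReal.measurable_ofReal.comp (measurable_norm.comp
        ((hflip n).continuous.measurable.sub (measurable_const.indicator hE.1)))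
    dsimp only
    rw [← lintegral_add_left hmeas]
    refine lintegral_mono fun x => ?_
    rw [← ENNReal.ofReal_add (abs_nonneg _) (abs_nonneg _)]
    refine ENNReal.ofReal_le_ofReal ?_
    have hind : (E ∩ F).indicator (fun _ => (1 : ℝ)) x =
        min (E.indicator (fun _ => (1 : ℝ)) x) (F.indicator (fun _ => (1 : ℝ)) x) := by
      by_cases hxE : x ∈ E <;> by_cases hxF : x ∈ F <;> simp [hxE, hxF]
    rw [hind]
    exact (abs_min_sub_min_le_max _ _ _ _).trans
      (max_le (le_add_of_nonneg_right (abs_nonneg _)) (le_add_of_nonneg_left (abs_nonneg _)))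
  · calc ∫⁻ x, lipConst (fun x => min (fn n x) (gn n x)) x ∂μ
        ≤ ∫⁻ x, (lipConst (fn n) x + lipConst (gn n) x) ∂μ :=
          lintegral_mono fun x => lipConst_min_le _ _ x
      _ = ∫⁻ x, lipConst (fn n) x ∂μ + ∫⁻ x, lipConst (gn n) x ∂μ :=
          lintegral_add_left (measurable_lipConst (hflip n).continuous) _
      _ ≤ C + D := add_le_add (hfC n) (hgD n)

theorem FinPerim.diff [BorelSpace X] {μ : Measure X} {E F : Set X} (hE : FinPerim μ E)
    (hF : FinPerim μ F) : FinPerim μ (E \ F) :=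
  hE.inter hF.compl

/-! ### Perimeters of partitions in isotropic spaces -/

/-- The representation formula forces the empty set to be null for the codimension-one
Hausdorff measure. -/
theorem PerimRepr.codimH_empty {μ : Measure X} {θ : Set X → X → ℝ≥0∞} (h : PerimRepr μ θ) :
    codimH μ ∅ = 0 := by
  obtain ⟨γ, C, -, -, hrep⟩ := h
  have hfin := (finPerim_empty μ).2
  have hzero : perim μ ∅ univ = _ := (hrep ∅ (finPerim_empty μ)).2 univ MeasurableSet.univ
  have hbd : essBdry μ (∅ : Set X) = ∅ := by
    ext x
    simp [essBdry, upperDens]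
  rw [hzero, hbd] at hfin
  by_contra hne
  simp [outerLint, hne, ENNReal.mul_top] at hfin

theorem PerimRepr.perim_univ {μ : Measure X} {θ : Set X → X → ℝ≥0∞}
    (h : PerimRepr μ θ) {E : Set X} (hE : FinPerim μ E) :
    perim μ E univ = outerLint (codimHOuter μ h.codimH_empty) (essBdry μ E) (θ E) := by
  obtain ⟨γ, C, -, -, hrep⟩ := id h
  simpa [coe_codimHOuter] using (hrep E hE).2 univ MeasurableSet.univ

theorem codimH_essBdry_inter_diff_eq_zero {μ : Measure X}
    {θ : Set X → X → ℝ≥0∞} (h : PerimRepr μ θ) {E F : Set X}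
    (hnull : codimH μ (essBdry μ F \ essBdry μ E) = 0) :
    codimH μ (essBdry μ (E ∩ F) \ essBdry μ E) = 0 := by
  change codimHOuter μ h.codimH_empty _ = 0
  refine measure_mono_null ?_ hnull
  rintro x ⟨hx, hxE⟩
  exact ⟨(essBdry_inter_subset μ E F hx).resolve_left hxE, hxE⟩

section Isotropic

variable [SecondCountableTopology X] [BorelSpace X] {μ : Measure X} [SFinite μ]
  {θ : Set X → X → ℝ≥0∞}

theorem PerimRepr.outerLint_inter_add_diff_essBdry (h : PerimRepr μ θ) {F : Set X}
    (hF : FinPerim μ F) (S : Set X) (f : X → ℝ≥0∞) :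
    outerLint (codimHOuter μ h.codimH_empty) S f =
      outerLint (codimHOuter μ h.codimH_empty) (S ∩ essBdry μ F) f +
        outerLint (codimHOuter μ h.codimH_empty) (S \ essBdry μ F) f :=
  outerLint_inter_add_diff _
    (codimHOuter_inter_add_diff μ _ (measurableSet_essBdry μ hF.1)) S f

/-- If the perimeter is additive on a partition `{F, G}` of `E`, then the essential boundary of
`F` is contained in that of `E` up to a null set. -/
theorem codimH_essBdry_diff_eq_zero (h : PerimRepr μ θ)
    (hiso : ∀ E F : Set X, FinPerim μ E → FinPerim μ F → F ⊆ E →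
      codimH μ {x ∈ essBdry μ F ∩ essBdry μ E | θ F x ≠ θ E x} = 0)
    {E F G : Set X} (hE : FinPerim μ E) (hF : FinPerim μ F) (hG : FinPerim μ G)
    (hunion : F ∪ G = E) (hper : perim μ E univ = perim μ F univ + perim μ G univ) :
    codimH μ (essBdry μ F \ essBdry μ E) = 0 := by
  obtain ⟨γ, C, hγ, -, hrep⟩ := id h
  set H := codimHOuter μ h.codimH_empty
  have hFE : F ⊆ E := hunion ▸ subset_union_left
  have hGE : G ⊆ E := hunion ▸ subset_union_right
  have hcover : essBdry μ E ⊆ essBdry μ F ∪ essBdry μ G := hunion ▸ essBdry_union_subset μ F G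
  have hle₁ : outerLint H (essBdry μ E ∩ essBdry μ F) (θ E) ≤
      outerLint H (essBdry μ F ∩ essBdry μ E) (θ F) := by
    refine outerLint_le_of_null H (measure_mono_null ?_ (hiso E F hE hF hFE))
    rintro x ⟨⟨hxE, hxF⟩, hx⟩
    exact ⟨⟨hxF, hxE⟩, fun heq => hx ⟨⟨hxF, hxE⟩, heq.symm⟩⟩
  have hle₂ : outerLint H (essBdry μ E \ essBdry μ F) (θ E) ≤
      outerLint H (essBdry μ G) (θ G) := by
    refine outerLint_le_of_null H (measure_mono_null ?_ (hiso E G hE hG hGE))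
    rintro x ⟨⟨hxE, hxF⟩, hx⟩
    have hxG := (hcover hxE).resolve_left hxF
    exact ⟨⟨hxG, hxE⟩, fun heq => hx ⟨hxG, heq.symm⟩⟩
  have hEfin : perim μ E univ ≠ ⊤ := hE.2.ne
  have hkey : perim μ E univ + outerLint H (essBdry μ F \ essBdry μ E) (θ F) ≤
      perim μ E univ + 0 := by
    calc perim μ E univ + outerLint H (essBdry μ F \ essBdry μ E) (θ F)
        = outerLint H (essBdry μ E ∩ essBdry μ F) (θ E) +
            outerLint H (essBdry μ E \ essBdry μ F) (θ E) +
            outerLint H (essBdry μ F \ essBdry μ E) (θ F) := by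
          rw [h.perim_univ hE, h.outerLint_inter_add_diff_essBdry hF (essBdry μ E)]
      _ ≤ outerLint H (essBdry μ F ∩ essBdry μ E) (θ F) +
            outerLint H (essBdry μ G) (θ G) +
            outerLint H (essBdry μ F \ essBdry μ E) (θ F) := by gcongr
      _ = perim μ F univ + perim μ G univ := by
          rw [h.perim_univ hF, h.perim_univ hG,
            h.outerLint_inter_add_diff_essBdry hE (essBdry μ F), add_right_comm]
      _ = perim μ E univ + 0 := by rw [← hper, add_zero]
  have hnull := nonpos_iff_eq_zero.1 ((ENNReal.add_le_add_iff_left hEfin).1 hkey)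
  exact measure_eq_zero_of_outerLint_eq_zero H hγ (fun x hx => ((hrep F hF).1 x hx.1).1) hnull

/-- The perimeter is additive on a partition `{F, G}` of `E` when the essential boundaries of `F`
and `G` lie in that of `E` and do not overlap, up to null sets. -/
theorem perim_eq_add_of_null (h : PerimRepr μ θ)
    (hiso : ∀ E F : Set X, FinPerim μ E → FinPerim μ F → F ⊆ E →
      codimH μ {x ∈ essBdry μ F ∩ essBdry μ E | θ F x ≠ θ E x} = 0)
    {E F G : Set X} (hE : FinPerim μ E) (hF : FinPerim μ F) (hG : FinPerim μ G)
    (hunion : F ∪ G = E) (hFnull : codimH μ (essBdry μ F \ essBdry μ E) = 0)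
    (hGnull : codimH μ (essBdry μ G \ essBdry μ E) = 0)
    (hFG : codimH μ (essBdry μ F ∩ essBdry μ G ∩ essBdry μ E) = 0) :
    perim μ E univ = perim μ F univ + perim μ G univ := by
  set H := codimHOuter μ h.codimH_empty
  have hFE : F ⊆ E := hunion ▸ subset_union_left
  have hGE : G ⊆ E := hunion ▸ subset_union_right
  have hcover : essBdry μ E ⊆ essBdry μ F ∪ essBdry μ G := hunion ▸ essBdry_union_subset μ F G
  have hnull : ∀ A ⊆ E, FinPerim μ A → codimH μ (essBdry μ A \ essBdry μ E) = 0 →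
      H ({x ∈ essBdry μ A ∩ essBdry μ E | θ A x ≠ θ E x} ∪ (essBdry μ A \ essBdry μ E) ∪
        (essBdry μ F ∩ essBdry μ G ∩ essBdry μ E)) = 0 := fun A hAE hA hA0 =>
    measure_union_null (measure_union_null (hiso E A hE hA hAE) hA0) hFG
  rw [h.perim_univ hE, h.perim_univ hF, h.perim_univ hG,
    h.outerLint_inter_add_diff_essBdry hF (essBdry μ E)]
  refine le_antisymm (add_le_add ?_ ?_) (add_le_add ?_ ?_)
  · refine outerLint_le_of_null H (measure_mono_null ?_ (hiso E F hE hF hFE))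
    rintro x ⟨⟨hxE, hxF⟩, hx⟩
    exact ⟨⟨hxF, hxE⟩, fun heq => hx ⟨hxF, heq.symm⟩⟩
  · refine outerLint_le_of_null H (measure_mono_null ?_ (hiso E G hE hG hGE))
    rintro x ⟨⟨hxE, hxF⟩, hx⟩
    have hxG := (hcover hxE).resolve_left hxF
    exact ⟨⟨hxG, hxE⟩, fun heq => hx ⟨hxG, heq.symm⟩⟩
  · refine outerLint_le_of_null H (measure_mono_null ?_ (hnull F hFE hF hFnull))
    rintro x ⟨hxF, hx⟩
    by_cases hxE : x ∈ essBdry μ E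
    · exact Or.inl (Or.inl ⟨⟨hxF, hxE⟩, fun heq => hx ⟨⟨hxE, hxF⟩, heq⟩⟩)
    · exact Or.inl (Or.inr ⟨hxF, hxE⟩)
  · refine outerLint_le_of_null H (measure_mono_null ?_ (hnull G hGE hG hGnull))
    rintro x ⟨hxG, hx⟩
    by_cases hxE : x ∈ essBdry μ E
    · by_cases hxF : x ∈ essBdry μ F
      · exact Or.inr ⟨⟨hxF, hxG⟩, hxE⟩
      · exact Or.inl (Or.inl ⟨⟨hxG, hxE⟩, fun heq => hx ⟨⟨hxE, hxF⟩, heq⟩⟩)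
    · exact Or.inl (Or.inr ⟨hxG, hxE⟩)

/-- Under property (1.2), an indecomposable set is not split by a set whose essential boundary
is contained in its own up to a null set. -/
theorem Indecomposable.inter_null_or_diff_null (h12 : Prop12 μ) (h : PerimRepr μ θ)
    (hiso : ∀ E F : Set X, FinPerim μ E → FinPerim μ F → F ⊆ E →
      codimH μ {x ∈ essBdry μ F ∩ essBdry μ E | θ F x ≠ θ E x} = 0)
    {E F : Set X} (hE : Indecomposable μ E) (hF : FinPerim μ F)
    (hnull : codimH μ (essBdry μ F \ essBdry μ E) = 0) :
    μ (E ∩ F) = 0 ∨ μ (E \ F) = 0 := by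
  by_contra! hpos
  have hdisj : Disjoint (E ∩ F) (E \ F) := disjoint_sdiff_inter.symm
  have hunion : E ∩ F ∪ E \ F = E := inter_union_sdiff E F
  have hI := hE.1.inter hF
  have hD := hE.1.diff hF
  have hFG := h12 _ _ hI hD hdisj
  rw [hunion] at hFG
  refine hE.2 ⟨E ∩ F, E \ F, hI, hD, hdisj, by rw [hunion, inter_univ],
    pos_iff_ne_zero.2 hpos.1, pos_iff_ne_zero.2 hpos.2,
    perim_eq_add_of_null h hiso hE.1 hI hD hunion ?_ ?_ hFG⟩
  · exact codimH_essBdry_inter_diff_eq_zero h hnull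
  · exact codimH_essBdry_inter_diff_eq_zero h (F := Fᶜ) (by rwa [essBdry_compl])

end Isotropic

end Auxiliary

variable {X : Type*} [MetricSpace X] [CompleteSpace X] [TopologicalSpace.SeparableSpace X]
  [MeasurableSpace X] [BorelSpace X]

/-- Simple sets vs. indecomposability of the set and its complement. -/
theorem simple_iff_indecomposable_compl
    (μ : Measure X) [IsLocallyFiniteMeasure μ] (hμ : μ ≠ 0)
    (hPI : IsPI μ) (hIso : Isotropic μ)
    (E : Set X) (hE : FinPerim μ E) (hEfin : μ E < ⊤) :
    (SimpleSet μ E → Indecomposable μ E ∧ Indecomposable μ Eᶜ) ∧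
    (Prop12 μ → Indecomposable μ E → Indecomposable μ Eᶜ → SimpleSet μ E) := by
  obtain ⟨θ, hθ, hiso⟩ := hIso
  have : SecondCountableTopology X := UniformSpace.secondCountable_of_separable X
  constructor
  · rintro ⟨-, -, hsimple⟩
    refine ⟨⟨hE, ?_⟩, ⟨hE.compl, ?_⟩⟩
    · rintro ⟨F, G, hF, hG, hdisj, hunion, hFpos, hGpos, hper⟩
      rw [inter_univ] at hunion
      have hFE : F ⊆ E := hunion ▸ subset_union_left
      rcases hsimple F hF (codimH_essBdry_diff_eq_zero hθ hiso hE hF hG hunion hper) with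
        h | h | h | h
      · exact hFpos.ne' h
      · exact hGpos.ne' (measure_mono_null hdisj.subset_compl_left h)
      · refine hGpos.ne' (measure_mono_null (fun x hx => Or.inr ?_) h)
        exact ⟨hunion ▸ Or.inr hx, disjoint_right.1 hdisj hx⟩
      · exact hFpos.ne' (measure_mono_null (fun x hx => Or.inl ⟨hx, fun h => h (hFE hx)⟩) h)
    · rintro ⟨F, G, hF, hG, hdisj, hunion, hFpos, hGpos, hper⟩
      rw [inter_univ] at hunion
      have hFE : F ⊆ Eᶜ := hunion ▸ subset_union_left
      have hnull := codimH_essBdry_diff_eq_zero hθ hiso hE.compl hF hG hunion hper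
      rw [essBdry_compl] at hnull
      rcases hsimple F hF hnull with h | h | h | h
      · exact hFpos.ne' h
      · exact hGpos.ne' (measure_mono_null hdisj.subset_compl_left h)
      · exact hFpos.ne' (measure_mono_null (fun x hx => Or.inl ⟨hx, hFE hx⟩) h)
      · refine hGpos.ne' (measure_mono_null (fun x hx => Or.inr ?_) h)
        exact ⟨hunion ▸ Or.inr hx, disjoint_right.1 hdisj hx⟩
  · intro h12 hEind hEcind
    refine ⟨hE, hEfin, fun F hF hnull => ?_⟩
    have h₁ := hEind.inter_null_or_diff_null h12 hθ hiso hF hnull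
    have h₂ := hEcind.inter_null_or_diff_null h12 hθ hiso hF (by rwa [essBdry_compl])
    rcases h₁ with h₁ | h₁ <;> rcases h₂ with h₂ | h₂
    · refine Or.inl (measure_mono_null (fun x hx => ?_) (measure_union_null h₁ h₂))
      by_cases hxE : x ∈ E
      · exact Or.inl ⟨hxE, hx⟩
      · exact Or.inr ⟨hxE, hx⟩
    · refine Or.inr (Or.inr (Or.inr
        (measure_mono_null (fun x hx => ?_) (measure_union_null h₁ h₂))))
      rcases hx with ⟨hxF, hxE⟩ | ⟨hxE, hxF⟩
      · exact Or.inl ⟨not_not.1 hxE, hxF⟩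
      · exact Or.inr ⟨hxE, hxF⟩
    · refine Or.inr (Or.inr (Or.inl
        (measure_mono_null (fun x hx => ?_) (measure_union_null h₁ h₂))))
      rcases hx with ⟨hxF, hxE⟩ | ⟨hxE, hxF⟩
      · exact Or.inr ⟨hxE, hxF⟩
      · exact Or.inl ⟨hxE, hxF⟩
    · refine Or.inr (Or.inl (measure_mono_null (fun x hx => ?_) (measure_union_null h₁ h₂)))
      by_cases hxE : x ∈ E
      · exact Or.inl ⟨hxE, hx⟩
      · exact Or.inr ⟨hxE, hx⟩

end PaperBV
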